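/- Let E = ℝ^d. Let f ∈ 𝒟_w and μ̄ ∈ 𝒫_w be such that f(μ̄) = max_{𝒫_w} f. Let τ : ℝ^d → ℝ^{d×d} be continuous. Define A_τ(φ) = tr(τ τ^⊤ ∇²φ) and ℵ_τ(φ ⊗ ψ)(x,y) = (τ(x)^⊤ ∇φ(x)) · (τ(y)^⊤ ∇ψ(y)), extended linearly to sums of tensor products. Assume A_τ maps C_w^∞ into L¹(ℝ^d, μ̄) and ℵ_τ maps C_w^∞ ⊗ C_w^∞ into L¹(ℝ^d × ℝ^d, μ̄ ⊗ μ̄). Then ⟨A_τ(∂f(μ̄)), μ̄⟩ + ⟨ℵ_τ(∂²f(μ̄)), μ̄²⟩ ≤ 0. -/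

import Mathlib

open MeasureTheory Filter Topology
open scoped NNReal ENNReal

noncomputable section

/-- The derivative `∂_x f(μ) = lim_{ε→0} (f(μ + ε δ_x) − f(μ))/ε` of a function of a
(nonnegative) measure argument, realized as the derivative at `0` from within `[0,∞)`
(which coincides with the two-sided derivative for the smooth functionals considered). -/
def mderiv {X : Type*} [MeasurableSpace X]
    (f : Measure X → ℝ) (μ : Measure X) (x : X) : ℝ :=
  derivWithin (fun ε : ℝ => f (μ + ENNReal.ofReal ε • Measure.dirac x)) (Set.Ici 0) 0

/-- The second derivative `∂²_{x,y} f(μ) = ∂_x(∂_y f)(μ)`. -/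
def mderiv2 {X : Type*} [MeasurableSpace X]
    (f : Measure X → ℝ) (μ : Measure X) (x y : X) : ℝ :=
  mderiv (fun ν => mderiv f ν y) μ x

/-- The generators `μ ↦ ⟨φ,μ⟩ e^{-⟨w,μ⟩}`, `φ ∈ C_c^∞(ℝ^d)`, of the algebra `𝒟_w`. -/
def DwGen {d : ℕ} (w : EuclideanSpace ℝ (Fin d) → ℝ) :
    Set (Measure (EuclideanSpace ℝ (Fin d)) → ℝ) :=
  {g | ∃ φ : EuclideanSpace ℝ (Fin d) → ℝ, ContDiff ℝ (⊤ : ℕ∞) φ ∧ HasCompactSupport φ ∧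
    g = fun μ => (∫ x, φ x ∂μ) * Real.exp (-(∫ x, w x ∂μ))}

/-- The space `C_w^∞`: the linear span of `w` and `C_c^∞(ℝ^d)`. -/
def CwInf {d : ℕ} (w : EuclideanSpace ℝ (Fin d) → ℝ) :
    Set (EuclideanSpace ℝ (Fin d) → ℝ) :=
  {φ | ∃ (c : ℝ) (ψ : EuclideanSpace ℝ (Fin d) → ℝ),
    ContDiff ℝ (⊤ : ℕ∞) ψ ∧ HasCompactSupport ψ ∧ φ = fun x => c * w x + ψ x}

/-- `A_τ(φ) = tr(τ τ^⊤ ∇²φ)`. -/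
def AtauTr {d : ℕ} (τ : EuclideanSpace ℝ (Fin d) → Fin d → Fin d → ℝ)
    (φ : EuclideanSpace ℝ (Fin d) → ℝ) (x : EuclideanSpace ℝ (Fin d)) : ℝ :=
  ∑ i, ∑ k, (∑ j, τ x i j * τ x k j) *
    gradient (fun y => gradient φ y k) x i

/-- `ℵ_τ`, on a function `ψ` of two variables:
`ℵ_τ(ψ)(x,y) = Σ_j Σ_{i,k} τ(x)_{ij} τ(y)_{kj} ∂_{x_i}∂_{y_k} ψ(x,y)`; on a tensor product
`ψ = φ₁ ⊗ φ₂` this is `(τ(x)^⊤∇φ₁(x)) ⬝ (τ(y)^⊤∇φ₂(y))`, extended linearly. -/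
def alephTau {d : ℕ} (τ : EuclideanSpace ℝ (Fin d) → Fin d → Fin d → ℝ)
    (ψ : EuclideanSpace ℝ (Fin d) → EuclideanSpace ℝ (Fin d) → ℝ)
    (x y : EuclideanSpace ℝ (Fin d)) : ℝ :=
  ∑ j, ∑ i, ∑ k, τ x i j * τ y k j *
    gradient (fun x' => gradient (fun y' => ψ x' y') y k) x i

section helpers

/-- `f` is a smooth function of the integral of a smooth vector-valued function. -/
def DwRep {d : ℕ} (w : EuclideanSpace ℝ (Fin d) → ℝ)
    (f : Measure (EuclideanSpace ℝ (Fin d)) → ℝ) : Prop :=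
  ∃ (V : Type) (_ : NormedAddCommGroup V) (_ : NormedSpace ℝ V) (_ : FiniteDimensional ℝ V)
    (Φ : EuclideanSpace ℝ (Fin d) → V) (F : V → ℝ),
    ContDiff ℝ (⊤ : ℕ∞) Φ ∧ ContDiff ℝ (⊤ : ℕ∞) F ∧
    (∀ L : V →L[ℝ] ℝ, (fun x => L (Φ x)) ∈ CwInf w) ∧
    (∀ μ : Measure (EuclideanSpace ℝ (Fin d)), IsFiniteMeasure μ → Integrable w μ →
      Integrable Φ μ) ∧
    (∀ μ : Measure (EuclideanSpace ℝ (Fin d)), IsFiniteMeasure μ → Integrable w μ →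
      f μ = F (∫ x, Φ x ∂μ))

lemma CwInf_add {d : ℕ} {w φ ψ : EuclideanSpace ℝ (Fin d) → ℝ}
    (h1 : φ ∈ CwInf w) (h2 : ψ ∈ CwInf w) : (fun x => φ x + ψ x) ∈ CwInf w := by
  obtain ⟨c, p, hp, hpc, rfl⟩ := h1
  obtain ⟨c', p', hp', hpc', rfl⟩ := h2
  refine ⟨c + c', p + p', hp.add hp', hpc.add hpc', ?_⟩
  funext x
  simp only [Pi.add_apply]
  ring

lemma rep_op {d : ℕ} {w : EuclideanSpace ℝ (Fin d) → ℝ}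
    {f g : Measure (EuclideanSpace ℝ (Fin d)) → ℝ} (hf : DwRep w f) (hg : DwRep w g)
    (op : ℝ → ℝ → ℝ) (hop : ContDiff ℝ (⊤ : ℕ∞) (fun p : ℝ × ℝ => op p.1 p.2)) :
    DwRep w (fun μ => op (f μ) (g μ)) := by
  obtain ⟨V, _, _, _, Φ, F, hΦ, hF, hL, hI, hr⟩ := hf
  obtain ⟨V', _, _, _, Φ', F', hΦ', hF', hL', hI', hr'⟩ := hg
  refine ⟨V × V', inferInstance, inferInstance, inferInstance, fun x => (Φ x, Φ' x),
    fun p => op (F p.1) (F' p.2), hΦ.prodMk hΦ', ?_, ?_, ?_, ?_⟩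
  · exact hop.comp ((hF.comp contDiff_fst).prodMk (hF'.comp contDiff_snd))
  · intro L
    have := CwInf_add (hL (L.comp (ContinuousLinearMap.inl ℝ V V')))
      (hL' (L.comp (ContinuousLinearMap.inr ℝ V V')))
    convert this using 2 with x
    simp [← map_add]
  · intro μ h1 h2
    exact (hI μ h1 h2).prodMk (hI' μ h1 h2)
  · intro μ h1 h2
    have : CompleteSpace V := FiniteDimensional.complete ℝ V
    have : CompleteSpace V' := FiniteDimensional.complete ℝ V'
    rw [integral_pair (hI μ h1 h2) (hI' μ h1 h2)]
    simp only [hr μ h1 h2, hr' μ h1 h2]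

lemma rep_gen {d : ℕ} {w φ : EuclideanSpace ℝ (Fin d) → ℝ} (hw : ContDiff ℝ (⊤ : ℕ∞) w)
    (h1 : ContDiff ℝ (⊤ : ℕ∞) φ) (h2 : HasCompactSupport φ)
    (F : ℝ × ℝ → ℝ) (hF : ContDiff ℝ (⊤ : ℕ∞) F) :
    DwRep w (fun μ => F (∫ x, φ x ∂μ, ∫ x, w x ∂μ)) := by
  have hi : ∀ μ : Measure (EuclideanSpace ℝ (Fin d)), IsFiniteMeasure μ → Integrable φ μ :=
    fun μ hμ => h1.continuous.integrable_of_hasCompactSupport h2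
  refine ⟨ℝ × ℝ, inferInstance, inferInstance, inferInstance, fun x => (φ x, w x),
    F, h1.prodMk hw, hF, ?_, ?_, ?_⟩
  · intro L
    refine ⟨L (0, 1), fun x => L (1, 0) * φ x, contDiff_const.mul h1, h2.mul_left, ?_⟩
    funext x
    have : (φ x, w x) = φ x • ((1, 0) : ℝ × ℝ) + w x • ((0, 1) : ℝ × ℝ) := by simp
    simp only [this, map_add, map_smul, smul_eq_mul]
    ring
  · intro μ h1 h2
    exact (hi μ h1).prodMk h2
  · intro μ h1 h2
    rw [integral_pair (hi μ h1) h2]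

lemma dwRep_of_mem {d : ℕ} {w : EuclideanSpace ℝ (Fin d) → ℝ} (hw : ContDiff ℝ (⊤ : ℕ∞) w)
    {f : Measure (EuclideanSpace ℝ (Fin d)) → ℝ}
    (hf : f ∈ NonUnitalAlgebra.adjoin ℝ (DwGen w)) : DwRep w f := by
  induction hf using NonUnitalAlgebra.adjoin_induction with
  | mem x hx =>
    obtain ⟨φ, h1, h2, rfl⟩ := hx
    exact rep_gen hw h1 h2 (fun p => p.1 * Real.exp (-p.2)) (by fun_prop)
  | add x y _ _ hx hy => exact rep_op hx hy (fun a b => a + b) (by fun_prop)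
  | zero =>
    exact rep_gen (φ := fun _ => 0) hw contDiff_const HasCompactSupport.zero
      (fun _ => 0) contDiff_const
  | mul x y _ _ hx hy => exact rep_op hx hy (fun a b => a * b) (by fun_prop)
  | smul r x _ hx => exact rep_op hx hx (fun a b => r * a) (by fun_prop)

lemma grad_apply {d : ℕ} (φ : EuclideanSpace ℝ (Fin d) → ℝ) (y : EuclideanSpace ℝ (Fin d))
    (k : Fin d) : gradient φ y k = fderiv ℝ φ y (EuclideanSpace.single k 1) := by
  have h : fderiv ℝ φ y (EuclideanSpace.single k 1) =
      inner ℝ (gradient φ y) (EuclideanSpace.single k 1) := by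
    rw [← toDual_gradient, InnerProductSpace.toDual_apply_apply]
  rw [h, EuclideanSpace.inner_single_right]
  simp

lemma mderiv_comp {X V : Type*} [MeasurableSpace X] [NormedAddCommGroup V] [NormedSpace ℝ V]
    [FiniteDimensional ℝ V] {f : Measure X → ℝ} {F : V → ℝ} {Φ : X → V} (hF : Differentiable ℝ F)
    {μ : Measure X} (hI : Integrable Φ μ) (hΦ : StronglyMeasurable Φ) (x : X)
    (hr : ∀ ε : ℝ, 0 ≤ ε → f (μ + ENNReal.ofReal ε • Measure.dirac x) =
      F (∫ z, Φ z ∂(μ + ENNReal.ofReal ε • Measure.dirac x))) :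
    mderiv f μ x = fderiv ℝ F (∫ z, Φ z ∂μ) (Φ x) := by
  have : CompleteSpace V := FiniteDimensional.complete ℝ V
  unfold mderiv
  have key : ∀ ε ∈ Set.Ici (0:ℝ), f (μ + ENNReal.ofReal ε • Measure.dirac x) =
      F ((∫ z, Φ z ∂μ) + ε • Φ x) := by
    intro ε hε
    have hd : Integrable Φ (Measure.dirac x) := 
      integrable_dirac' hΦ (by simp)
    rw [hr ε hε, integral_add_measure hI (hd.smul_measure ENNReal.ofReal_ne_top),
      integral_smul_measure, integral_dirac' _ _ hΦ, ENNReal.toReal_ofReal hε]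
  have hd : HasDerivAt (fun ε : ℝ => F ((∫ z, Φ z ∂μ) + ε • Φ x))
      (fderiv ℝ F (∫ z, Φ z ∂μ) (Φ x)) 0 := by
    have h1 : HasDerivAt (fun ε : ℝ => (∫ z, Φ z ∂μ) + ε • Φ x) (Φ x) 0 := by
      simpa using ((hasDerivAt_id (0:ℝ)).smul_const (Φ x)).const_add (∫ z, Φ z ∂μ)
    have h2 : HasFDerivAt F (fderiv ℝ F (∫ z, Φ z ∂μ)) ((∫ z, Φ z ∂μ) + (0:ℝ) • Φ x) := by
      simpa using (hF _).hasFDerivAt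
    exact h2.comp_hasDerivAt (0:ℝ) h1
  rw [derivWithin_congr key (key 0 (by simp))]
  exact hd.hasDerivWithinAt.derivWithin (uniqueDiffOn_Ici 0 0 (by simp))

lemma bdd_of {E V : Type*} [TopologicalSpace E] [NormedAddCommGroup V] {k : ℝ → E → V}
    (hk : Continuous (fun p : ℝ × E => k p.1 p.2)) {K : Set E} (hK : IsCompact K)
    (hz : ∀ t, ∀ x ∉ K, k t x = 0) (t0 : ℝ) :
    ∃ C, ∀ t ∈ Metric.closedBall t0 1, ∀ x, ‖k t x‖ ≤ C := by
  obtain ⟨C, hC⟩ := ((isCompact_closedBall t0 1).prod hK).exists_bound_of_continuousOn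
    hk.continuousOn
  refine ⟨max C 0, fun t ht x => ?_⟩
  by_cases hx : x ∈ K
  · exact (hC (t, x) ⟨ht, hx⟩).trans (le_max_left _ _)
  · rw [hz t x hx]; simp

lemma deriv_int {E V : Type*} [PseudoMetricSpace E] [MeasurableSpace E] [BorelSpace E]
    [SecondCountableTopology E]
    [NormedAddCommGroup V] [NormedSpace ℝ V] {μ : Measure E} [IsFiniteMeasure μ]
    {k k' : ℝ → E → V} (hki : ∀ t, Integrable (k t) μ)
    (hk' : Continuous (fun p : ℝ × E => k' p.1 p.2)) {K : Set E} (hK : IsCompact K)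
    (hz : ∀ t, ∀ x ∉ K, k' t x = 0)
    (hd : ∀ t x, HasDerivAt (fun s => k s x) (k' t x) t) (t0 : ℝ) :
    Integrable (k' t0) μ ∧ HasDerivAt (fun t => ∫ x, k t x ∂μ) (∫ x, k' t0 x ∂μ) t0 := by
  obtain ⟨C, hC⟩ := bdd_of hk' hK hz t0
  have hc : Continuous (k' t0) := hk'.comp (by fun_prop : Continuous fun x : E => (t0, x))
  refine hasDerivAt_integral_of_dominated_loc_of_deriv_le (s := Metric.closedBall t0 1)
    (bound := fun _ => C) (Metric.closedBall_mem_nhds _ one_pos)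
    (Eventually.of_forall fun t => (hki t).aestronglyMeasurable) (hki t0) ?_
    (Eventually.of_forall fun x t ht => hC t ht x) (integrable_const _)
    (Eventually.of_forall fun x t _ => hd t x)
  exact hc.aestronglyMeasurable

lemma second_test {g g' : ℝ → ℝ} {g'' : ℝ} (h1 : ∀ t, HasDerivAt g (g' t) t)
    (h2 : HasDerivAt g' g'' 0) (hm : ∀ t, g t ≤ g 0) : g'' ≤ 0 := by
  by_contra! hpos
  have e : deriv g = g' := funext fun t => (h1 t).deriv
  have hmax : IsLocalMax g 0 := Eventually.of_forall hm
  have hmin : IsLocalMin g 0 := by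
    refine isLocalMin_of_deriv_deriv_pos ?_ hmax.deriv_eq_zero (h1 0).continuousAt
    rw [e, h2.deriv]; exact hpos
  have hc : g =ᶠ[𝓝 0] fun _ => g 0 := by
    filter_upwards [hmin] with t ht
    exact le_antisymm (hm t) ht
  have := hc.deriv.deriv_eq
  rw [e, h2.deriv] at this
  simp at this
  linarith

lemma core {E V : Type*} [NormedAddCommGroup E] [NormedSpace ℝ E] [MeasurableSpace E]
    [BorelSpace E] [SecondCountableTopology E]
    [NormedAddCommGroup V] [NormedSpace ℝ V] {μ : Measure E} [IsFiniteMeasure μ]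
    {Φ : E → V} {F : V → ℝ} (hΦ : ContDiff ℝ (⊤ : ℕ∞) Φ) (hF : ContDiff ℝ (⊤ : ℕ∞) F)
    (v : E → E) (hv : Continuous v) {K : Set E} (hK : IsCompact K) (hz : ∀ x ∉ K, v x = 0)
    (hI : Integrable Φ μ)
    (hm : ∀ t : ℝ, F (∫ x, Φ (x + t • v x) ∂μ) ≤ F (∫ x, Φ x ∂μ)) :
    Integrable (fun x => fderiv ℝ Φ x (v x)) μ ∧
    Integrable (fun x => fderiv ℝ (fderiv ℝ Φ) x (v x) (v x)) μ ∧
    fderiv ℝ (fderiv ℝ F) (∫ x, Φ x ∂μ) (∫ x, fderiv ℝ Φ x (v x) ∂μ)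
      (∫ x, fderiv ℝ Φ x (v x) ∂μ) +
    fderiv ℝ F (∫ x, Φ x ∂μ) (∫ x, fderiv ℝ (fderiv ℝ Φ) x (v x) (v x) ∂μ) ≤ 0 := by
  have hΦ1 : ContDiff ℝ (⊤ : ℕ∞) (fderiv ℝ Φ) := hΦ.fderiv_right (by simp)
  have hF1 : ContDiff ℝ (⊤ : ℕ∞) (fderiv ℝ F) := hF.fderiv_right (by simp)
  have hΦ2 : ContDiff ℝ (⊤ : ℕ∞) (fderiv ℝ (fderiv ℝ Φ)) := hΦ1.fderiv_right (by simp)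
  have hΦc := hΦ.continuous
  have hΦ1c := hΦ1.continuous
  have hΦ2c := hΦ2.continuous
  have htop : ((⊤ : ℕ∞) : WithTop ℕ∞) ≠ 0 := by simp
  have hline : ∀ t x, HasDerivAt (fun s : ℝ => x + s • v x) (v x) t := by
    intro t x
    simpa using ((hasDerivAt_id t).smul_const (v x)).const_add x
  have d1 : ∀ t x, HasDerivAt (fun s : ℝ => Φ (x + s • v x))
      (fderiv ℝ Φ (x + t • v x) (v x)) t := fun t x =>
    ((hΦ.differentiable htop _).hasFDerivAt).comp_hasDerivAt t (hline t x)
  have d2 : ∀ t x, HasDerivAt (fun s : ℝ => fderiv ℝ Φ (x + s • v x) (v x))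
      (fderiv ℝ (fderiv ℝ Φ) (x + t • v x) (v x) (v x)) t := by
    intro t x
    have := ((hΦ1.differentiable htop (x + t • v x)).hasFDerivAt).comp_hasDerivAt t (hline t x)
    simpa using this.clm_apply (hasDerivAt_const t (v x))
  have hi0 : ∀ t : ℝ, Integrable (fun x => Φ (x + t • v x)) μ := by
    intro t
    have hc : Continuous (fun x => Φ (x + t • v x) - Φ x) := by fun_prop
    have h : Integrable (fun x => Φ (x + t • v x) - Φ x) μ := by
      obtain ⟨C, hC⟩ := hK.exists_bound_of_continuousOn hc.continuousOn
      refine Integrable.of_bound hc.aestronglyMeasurable (max C 0)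
        (Eventually.of_forall fun x => ?_)
      by_cases hx : x ∈ K
      · exact (hC x hx).trans (le_max_left _ _)
      · simp [hz x hx]
    refine (h.add hI).congr (Eventually.of_forall fun x => ?_)
    simp
  have h1 := fun t => deriv_int (μ := μ) (k := fun t x => Φ (x + t • v x))
    (k' := fun t x => fderiv ℝ Φ (x + t • v x) (v x)) hi0
    (by fun_prop) hK (fun t x hx => by simp [hz x hx]) d1 t
  have h2 := deriv_int (μ := μ) (k := fun t x => fderiv ℝ Φ (x + t • v x) (v x))
    (k' := fun t x => fderiv ℝ (fderiv ℝ Φ) (x + t • v x) (v x) (v x))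
    (fun t => (h1 t).1)
    (by fun_prop) hK (fun t x hx => by simp [hz x hx]) d2 0
  refine ⟨by simpa using (h1 0).1, by simpa using h2.1, ?_⟩
  have g1 : ∀ t, HasDerivAt (fun t : ℝ => F (∫ x, Φ (x + t • v x) ∂μ))
      (fderiv ℝ F (∫ x, Φ (x + t • v x) ∂μ) (∫ x, fderiv ℝ Φ (x + t • v x) (v x) ∂μ)) t :=
    fun t => ((hF.differentiable htop _).hasFDerivAt).comp_hasDerivAt t (h1 t).2
  have g2 := (((hF1.differentiable htop _).hasFDerivAt).comp_hasDerivAt (0:ℝ) (h1 0).2).clm_apply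
    h2.2
  have := second_test g1 g2 (fun t => by simpa using hm t)
  simpa using this

lemma atau_eq {d : ℕ} {V : Type*} [NormedAddCommGroup V] [NormedSpace ℝ V]
    (τ : EuclideanSpace ℝ (Fin d) → Fin d → Fin d → ℝ)
    {Φ : EuclideanSpace ℝ (Fin d) → V} (hΦ : ContDiff ℝ (⊤ : ℕ∞) Φ) (L : V →L[ℝ] ℝ)
    (x : EuclideanSpace ℝ (Fin d)) :
    AtauTr τ (fun y => L (Φ y)) x = ∑ j, L (fderiv ℝ (fderiv ℝ Φ) x
      (WithLp.toLp 2 (fun i => τ x i j)) (WithLp.toLp 2 (fun i => τ x i j))) := by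
  have hΦ1 : ContDiff ℝ (⊤ : ℕ∞) (fderiv ℝ Φ) := hΦ.fderiv_right (by simp)
  have htop : ((⊤ : ℕ∞) : WithTop ℕ∞) ≠ 0 := by simp
  have e1 : ∀ y k, gradient (fun y => L (Φ y)) y k =
      L (fderiv ℝ Φ y (EuclideanSpace.single k 1)) := by
    intro y k
    rw [grad_apply]
    have := L.hasFDerivAt.comp y (hΦ.differentiable htop y).hasFDerivAt
    rw [show (fun y => L (Φ y)) = L ∘ Φ from rfl, this.fderiv]
    rfl
  have e2 : ∀ i k, gradient (fun y => L (fderiv ℝ Φ y (EuclideanSpace.single k 1))) x i =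
      L (fderiv ℝ (fderiv ℝ Φ) x (EuclideanSpace.single i 1) (EuclideanSpace.single k 1)) := by
    intro i k
    rw [grad_apply]
    have := L.hasFDerivAt.comp x ((hΦ1.differentiable htop x).hasFDerivAt.clm_apply
      (hasFDerivAt_const (EuclideanSpace.single k (1:ℝ)) x))
    have h2 := this.fderiv
    rw [Function.comp_def] at h2
    rw [h2]
    simp
  have e3 : ∀ j, (WithLp.toLp 2 (fun i => τ x i j) : EuclideanSpace ℝ (Fin d)) =
      ∑ i, τ x i j • EuclideanSpace.single i (1:ℝ) := by
    intro j
    ext i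
    simp [Finset.sum_apply, Pi.single_apply]
  unfold AtauTr
  simp only [e1, e2, e3, map_sum, map_smul, sum_apply,
    smul_apply, smul_eq_mul, Finset.sum_mul]
  simp only [Finset.mul_sum]
  rw [Finset.sum_comm]
  conv_rhs => rw [Finset.sum_comm]
  refine Finset.sum_congr rfl fun k _ => ?_
  rw [Finset.sum_comm]
  refine Finset.sum_congr rfl fun j _ => Finset.sum_congr rfl fun i _ => ?_
  ring

lemma aleph_eq {d : ℕ} {V : Type*} [NormedAddCommGroup V] [NormedSpace ℝ V]
    (τ : EuclideanSpace ℝ (Fin d) → Fin d → Fin d → ℝ)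
    {Φ : EuclideanSpace ℝ (Fin d) → V} (hΦ : ContDiff ℝ (⊤ : ℕ∞) Φ) (B : V →L[ℝ] V →L[ℝ] ℝ)
    (x y : EuclideanSpace ℝ (Fin d)) :
    alephTau τ (fun x y => B (Φ x) (Φ y)) x y = ∑ j, B
      (fderiv ℝ Φ x (WithLp.toLp 2 (fun i => τ x i j)))
      (fderiv ℝ Φ y (WithLp.toLp 2 (fun i => τ y i j))) := by
  have htop : ((⊤ : ℕ∞) : WithTop ℕ∞) ≠ 0 := by simp
  have e1 : ∀ (L : V →L[ℝ] ℝ) y k, gradient (fun y => L (Φ y)) y k =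
      L (fderiv ℝ Φ y (EuclideanSpace.single k 1)) := by
    intro L y k
    rw [grad_apply]
    have := L.hasFDerivAt.comp y (hΦ.differentiable htop y).hasFDerivAt
    rw [show (fun y => L (Φ y)) = L ∘ Φ from rfl, this.fderiv]
    rfl
  have e2 : ∀ u x k, gradient (fun x => B (Φ x) u) x k =
      B (fderiv ℝ Φ x (EuclideanSpace.single k 1)) u := by
    intro u x k
    exact e1 (B.flip u) x k
  have e3 : ∀ x j, (WithLp.toLp 2 (fun i => τ x i j) : EuclideanSpace ℝ (Fin d)) =
      ∑ i, τ x i j • EuclideanSpace.single i (1:ℝ) := by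
    intro x j
    ext i
    simp [Finset.sum_apply, Pi.single_apply]
  unfold alephTau
  simp only [e1, e2, e3, map_sum, map_smul, sum_apply,
    smul_apply, smul_eq_mul]
  simp only [Finset.mul_sum]
  refine Finset.sum_congr rfl fun j _ => ?_
  rw [Finset.sum_comm]
  refine Finset.sum_congr rfl fun k _ => Finset.sum_congr rfl fun i _ => ?_
  ring

lemma bilin_prod {E V : Type*} [MeasurableSpace E] [NormedAddCommGroup V] [NormedSpace ℝ V]
    [CompleteSpace V] {μ : Measure E} [IsFiniteMeasure μ] (B : V →L[ℝ] V →L[ℝ] ℝ) {p : E → V}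
    (hp : Integrable p μ) : Integrable (fun z : E × E => B (p z.1) (p z.2)) (μ.prod μ) ∧
    B (∫ x, p x ∂μ) (∫ x, p x ∂μ) = ∫ z : E × E, B (p z.1) (p z.2) ∂(μ.prod μ) := by
  have hi : Integrable (fun z : E × E => B (p z.1) (p z.2)) (μ.prod μ) := by
    refine Integrable.op_fst_snd (op := fun a b => B a b) (by fun_prop) ⟨‖B‖, fun a b => ?_⟩ hp hp
    exact B.le_opNorm₂ a b
  refine ⟨hi, ?_⟩
  rw [integral_prod _ hi]
  have h1 : ∀ x, ∫ y, B (p x) (p y) ∂μ = B (p x) (∫ y, p y ∂μ) :=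
    fun x => (B (p x)).integral_comp_comm hp
  simp_rw [h1]
  exact ((B.flip (∫ y, p y ∂μ)).integral_comp_comm hp).symm

end helpers

/-- Let `E = ℝ^d`, `f ∈ 𝒟_w` and `μ̄ ∈ 𝒫_w` with `f(μ̄) = max_{𝒫_w} f`, and
let `τ : ℝ^d → ℝ^{d×d}` be continuous.  With `A_τ(φ) = tr(τ τ^⊤ ∇²φ)` and `ℵ_τ` as before,
if `A_τ` maps `C_w^∞` into `L¹(μ̄)` and `ℵ_τ` maps `C_w^∞ ⊗ C_w^∞` into `L¹(μ̄ ⊗ μ̄)`, then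
`⟨A_τ(∂f(μ̄)), μ̄⟩ + ⟨ℵ_τ(∂²f(μ̄)), μ̄²⟩ ≤ 0`. -/
theorem stmt_16 {d : ℕ} (w : EuclideanSpace ℝ (Fin d) → ℝ)
    (hw_smooth : ContDiff ℝ (⊤ : ℕ∞) w) (hw_one : ∀ x, 1 ≤ w x)
    (hw_infty : Tendsto w (cocompact (EuclideanSpace ℝ (Fin d))) atTop)
    (Pw : Set (Measure (EuclideanSpace ℝ (Fin d))))
    (hPw : Pw = {μ | IsProbabilityMeasure μ ∧ Integrable w μ})
    (f : Measure (EuclideanSpace ℝ (Fin d)) → ℝ)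
    (hf : f ∈ NonUnitalAlgebra.adjoin ℝ (DwGen w))
    (μbar : Measure (EuclideanSpace ℝ (Fin d))) (hμbar : μbar ∈ Pw)
    (hmax : ∀ μ ∈ Pw, f μ ≤ f μbar)
    (τ : EuclideanSpace ℝ (Fin d) → Fin d → Fin d → ℝ)
    (hτ_cont : ∀ i j, Continuous (fun x => τ x i j))
    -- `A_τ` maps `C_w^∞` into `L¹(ℝ^d, μ̄)`:
    (hA_int : ∀ φ ∈ CwInf w, Integrable (AtauTr τ φ) μbar)
    -- `ℵ_τ` maps `C_w^∞ ⊗ C_w^∞` into `L¹(ℝ^d × ℝ^d, μ̄ ⊗ μ̄)`: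
    (hAleph_int : ∀ ψ : EuclideanSpace ℝ (Fin d) × EuclideanSpace ℝ (Fin d) → ℝ,
      ψ ∈ Submodule.span ℝ {g | ∃ φ₁ ∈ CwInf w, ∃ φ₂ ∈ CwInf w,
        g = fun p : EuclideanSpace ℝ (Fin d) × EuclideanSpace ℝ (Fin d) => φ₁ p.1 * φ₂ p.2} →
      Integrable (fun p => alephTau τ (fun x y => ψ (x, y)) p.1 p.2) (μbar.prod μbar)) :
    (∫ x, AtauTr τ (fun y => mderiv f μbar y) x ∂μbar) +
      (∫ p, alephTau τ (fun x y => mderiv2 f μbar x y) p.1 p.2 ∂(μbar.prod μbar)) ≤ 0 := by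
  obtain ⟨V, _, _, _, Φ, F, hΦ, hF, hL, hI, hr⟩ := dwRep_of_mem hw_smooth hf
  subst hPw
  obtain ⟨hprob, hwi⟩ := hμbar
  have : CompleteSpace V := FiniteDimensional.complete ℝ V
  have htop : ((⊤ : ℕ∞) : WithTop ℕ∞) ≠ 0 := by simp
  have hΦc := hΦ.continuous
  have hwc := hw_smooth.continuous
  have hF1 : ContDiff ℝ (⊤ : ℕ∞) (fderiv ℝ F) := hF.fderiv_right (by simp)
  have hfin : ∀ ν : Measure (EuclideanSpace ℝ (Fin d)), IsFiniteMeasure ν → ∀ (ε : ℝ) x,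
      IsFiniteMeasure (ν + ENNReal.ofReal ε • Measure.dirac x) := by
    intro ν hν ε x
    have : IsFiniteMeasure (ENNReal.ofReal ε • Measure.dirac x) :=
      Measure.smul_finite _ ENNReal.ofReal_ne_top
    infer_instance
  have hwint : ∀ ν : Measure (EuclideanSpace ℝ (Fin d)), Integrable w ν → ∀ (ε : ℝ) x,
      Integrable w (ν + ENNReal.ofReal ε • Measure.dirac x) := by
    intro ν hν ε x
    exact hν.add_measure ((integrable_dirac' hwc.stronglyMeasurable (by simp)).smul_measure
      ENNReal.ofReal_ne_top)
  have hmd : ∀ ν : Measure (EuclideanSpace ℝ (Fin d)), IsFiniteMeasure ν → Integrable w ν →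
      ∀ y, mderiv f ν y = fderiv ℝ F (∫ z, Φ z ∂ν) (Φ y) := by
    intro ν h1 h2 y
    exact mderiv_comp (hF.differentiable htop) (hI ν h1 h2) hΦc.stronglyMeasurable y
      (fun ε _ => hr _ (hfin ν h1 ε y) (hwint ν h2 ε y))
  have hmd2 : ∀ x y, mderiv2 f μbar x y =
      fderiv ℝ (fderiv ℝ F) (∫ z, Φ z ∂μbar) (Φ x) (Φ y) := by
    intro x y
    unfold mderiv2
    have hd := hF1.differentiable htop
    rw [mderiv_comp (F := fun z => fderiv ℝ F z (Φ y)) (by fun_prop)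
      (hI μbar inferInstance hwi) hΦc.stronglyMeasurable x
      (fun ε _ => hmd _ (hfin μbar inferInstance ε x) (hwint μbar hwi ε x) y)]
    rw [((hd _).hasFDerivAt.clm_apply (hasFDerivAt_const (Φ y) _)).fderiv]
    simp
  simp only [hmd μbar inferInstance hwi, hmd2]
  have hcore := fun v hv K hK hz => core (μ := μbar) (Φ := Φ) (F := F) hΦ hF v hv (K := K) hK hz
    (hI μbar inferInstance hwi)
  have hmaxt : ∀ v : EuclideanSpace ℝ (Fin d) → EuclideanSpace ℝ (Fin d), Continuous v →
      ∀ K : Set (EuclideanSpace ℝ (Fin d)), IsCompact K → (∀ x ∉ K, v x = 0) →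
      ∀ t : ℝ, F (∫ x, Φ (x + t • v x) ∂μbar) ≤ F (∫ x, Φ x ∂μbar) := by
    intro v hv K hK hz t
    have hc : Continuous (fun x => x + t • v x) := by fun_prop
    have hp : IsProbabilityMeasure (μbar.map (fun x => x + t • v x)) :=
      Measure.isProbabilityMeasure_map hc.aemeasurable
    have hwm : Integrable w (μbar.map (fun x => x + t • v x)) := by
      rw [integrable_map_measure hwc.aestronglyMeasurable hc.aemeasurable]
      have hc2 : Continuous (fun x => w (x + t • v x) - w x) := by fun_prop
      have h : Integrable (fun x => w (x + t • v x) - w x) μbar := by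
        obtain ⟨C, hC⟩ := hK.exists_bound_of_continuousOn hc2.continuousOn
        refine Integrable.of_bound hc2.aestronglyMeasurable (max C 0)
          (Eventually.of_forall fun x => ?_)
        by_cases hx : x ∈ K
        · exact (hC x hx).trans (le_max_left _ _)
        · simp [hz x hx]
      refine (h.add hwi).congr (Eventually.of_forall fun x => ?_)
      simp
    have := hmax _ ⟨hp, hwm⟩
    rw [hr _ inferInstance hwm, hr _ inferInstance hwi,
      integral_map hc.aemeasurable hΦc.aestronglyMeasurable] at this
    exact this
  set L := fderiv ℝ F (∫ z, Φ z ∂μbar) with hLdef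
  set B := fderiv ℝ (fderiv ℝ F) (∫ z, Φ z ∂μbar) with hBdef
  have hAi : Integrable (AtauTr τ (fun y => L (Φ y))) μbar := hA_int _ (hL L)
  have hBi : Integrable (fun p : EuclideanSpace ℝ (Fin d) × EuclideanSpace ℝ (Fin d) =>
      alephTau τ (fun x y => B (Φ x) (Φ y)) p.1 p.2) (μbar.prod μbar) := by
    refine hAleph_int (fun p => B (Φ p.1) (Φ p.2)) ?_
    let b := Module.finBasis ℝ V
    have e : ∀ u v, B u v = ∑ i, ∑ j, (B (b i) (b j)) * (b.coord i u * b.coord j v) := by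
      intro u v
      conv_lhs => rw [← b.sum_repr u, ← b.sum_repr v]
      simp only [map_sum, map_smul, sum_apply, smul_apply, smul_eq_mul, Module.Basis.coord_apply]
      simp only [Finset.mul_sum]
      rw [Finset.sum_comm]
      refine Finset.sum_congr rfl fun i _ => Finset.sum_congr rfl fun j _ => ?_
      ring
    have e2 : (fun p : EuclideanSpace ℝ (Fin d) × EuclideanSpace ℝ (Fin d) =>
        B (Φ p.1) (Φ p.2)) = ∑ i, ∑ j, (B (b i) (b j)) •
          (fun p : EuclideanSpace ℝ (Fin d) × EuclideanSpace ℝ (Fin d) =>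
            b.coord i (Φ p.1) * b.coord j (Φ p.2)) := by
      funext p
      rw [e]
      simp [Finset.sum_apply]
    rw [e2]
    refine Submodule.sum_mem _ fun i _ => Submodule.sum_mem _ fun j _ =>
      Submodule.smul_mem _ _ (Submodule.subset_span ?_)
    exact ⟨_, hL (b.coord i).toContinuousLinearMap, _, hL (b.coord j).toContinuousLinearMap, rfl⟩
  let χ : ℕ → EuclideanSpace ℝ (Fin d) → ℝ := fun n x => max 0 (1 - ‖x‖ / (n + 1))
  have hχc : ∀ n, Continuous (χ n) := by intro n; fun_prop
  have hχ0 : ∀ n x, 0 ≤ χ n x := fun n x => le_max_left _ _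
  have hχ1 : ∀ n x, χ n x ≤ 1 := fun n x => max_le zero_le_one (by
    have : 0 ≤ ‖x‖ / ((n:ℝ) + 1) := by positivity
    linarith)
  have hχz : ∀ n : ℕ, ∀ x ∉ Metric.closedBall (0 : EuclideanSpace ℝ (Fin d)) (n + 1),
      χ n x = 0 := by
    intro n x hx
    have hx' : (n:ℝ) + 1 < ‖x‖ := by simpa using hx
    refine max_eq_left ?_
    have : 1 ≤ ‖x‖ / ((n:ℝ) + 1) := by
      rw [le_div_iff₀ (by positivity)]; linarith
    linarith
  have hχt : ∀ x, Tendsto (fun n => χ n x) atTop (𝓝 1) := by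
    intro x
    have h1 : Tendsto (fun n : ℕ => ‖x‖ / ((n:ℝ) + 1)) atTop (𝓝 0) :=
      tendsto_const_nhds.div_atTop (tendsto_natCast_atTop_atTop.atTop_add tendsto_const_nhds)
    have h2 := (tendsto_const_nhds (x := (0:ℝ))).max (h1.const_sub 1)
    simpa using h2
  have hn : ∀ n, (∫ x, (χ n x * χ n x) * AtauTr τ (fun y => L (Φ y)) x ∂μbar) +
      (∫ p : EuclideanSpace ℝ (Fin d) × EuclideanSpace ℝ (Fin d), (χ n p.1 * χ n p.2) *
        alephTau τ (fun x y => B (Φ x) (Φ y)) p.1 p.2 ∂(μbar.prod μbar)) ≤ 0 := by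
    intro n
    let v : Fin d → EuclideanSpace ℝ (Fin d) → EuclideanSpace ℝ (Fin d) := fun j x =>
      χ n x • WithLp.toLp 2 (fun i => τ x i j)
    have hvc : ∀ j, Continuous (v j) := by
      intro j
      refine (hχc n).smul ((PiLp.continuous_toLp 2 _).comp (continuous_pi fun i => hτ_cont i j))
    have hvz : ∀ j, ∀ x ∉ Metric.closedBall (0 : EuclideanSpace ℝ (Fin d)) (n + 1),
        v j x = 0 := by
      intro j x hx
      simp [v, hχz n x hx]
    have hc := fun j => hcore (v j) (hvc j) _ (isCompact_closedBall 0 (n + 1)) (hvz j)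
      (hmaxt (v j) (hvc j) _ (isCompact_closedBall 0 (n + 1)) (hvz j))
    have eA : (∫ x, (χ n x * χ n x) * AtauTr τ (fun y => L (Φ y)) x ∂μbar) =
        ∑ j, L (∫ x, fderiv ℝ (fderiv ℝ Φ) x (v j x) (v j x) ∂μbar) := by
      simp_rw [atau_eq τ hΦ L]
      have : ∀ j, L (∫ x, fderiv ℝ (fderiv ℝ Φ) x (v j x) (v j x) ∂μbar) =
          ∫ x, L (fderiv ℝ (fderiv ℝ Φ) x (v j x) (v j x)) ∂μbar :=
        fun j => (L.integral_comp_comm (hc j).2.1).symm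
      simp_rw [this]
      rw [← integral_finsetSum _ (fun j _ => L.integrable_comp (hc j).2.1)]
      congr 1
      funext x
      rw [Finset.mul_sum]
      refine Finset.sum_congr rfl fun j _ => ?_
      simp only [v, map_smul, smul_apply, smul_eq_mul]
      ring
    have eB : (∫ p : EuclideanSpace ℝ (Fin d) × EuclideanSpace ℝ (Fin d), (χ n p.1 * χ n p.2) *
        alephTau τ (fun x y => B (Φ x) (Φ y)) p.1 p.2 ∂(μbar.prod μbar)) =
        ∑ j, B (∫ x, fderiv ℝ Φ x (v j x) ∂μbar) (∫ x, fderiv ℝ Φ x (v j x) ∂μbar) := by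
      simp_rw [aleph_eq τ hΦ B]
      have := fun j => bilin_prod (μ := μbar) B (hc j).1
      simp_rw [(this _).2]
      rw [← integral_finsetSum _ (fun j _ => (this j).1)]
      congr 1
      funext x
      rw [Finset.mul_sum]
      refine Finset.sum_congr rfl fun j _ => ?_
      simp only [v, map_smul, smul_apply, smul_eq_mul]
      ring
    rw [eA, eB, ← Finset.sum_add_distrib]
    refine Finset.sum_nonpos fun j _ => ?_
    have := (hc j).2.2
    linarith
  have hχm : ∀ a b : ℝ, 0 ≤ a → a ≤ 1 → 0 ≤ b → b ≤ 1 → ∀ c : ℝ, ‖(a * b) * c‖ ≤ ‖c‖ := by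
    intro a b h1 h2 h3 h4 c
    rw [norm_mul]
    refine mul_le_of_le_one_left (norm_nonneg _) ?_
    rw [Real.norm_of_nonneg (mul_nonneg h1 h3)]
    exact mul_le_one₀ h2 h3 h4
  have t1 : Tendsto (fun n => ∫ x, (χ n x * χ n x) * AtauTr τ (fun y => L (Φ y)) x ∂μbar) atTop
      (𝓝 (∫ x, AtauTr τ (fun y => L (Φ y)) x ∂μbar)) := by
    refine tendsto_integral_of_dominated_convergence _ (fun n => ?_) hAi.norm
      (fun n => Eventually.of_forall fun x => hχm _ _ (hχ0 _ _) (hχ1 _ _) (hχ0 _ _) (hχ1 _ _) _)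
      (Eventually.of_forall fun x => ?_)
    · exact ((hχc n).mul (hχc n)).aestronglyMeasurable.mul hAi.aestronglyMeasurable
    · simpa using ((hχt x).mul (hχt x)).mul_const (AtauTr τ (fun y => L (Φ y)) x)
  have t2 : Tendsto (fun n => ∫ p : EuclideanSpace ℝ (Fin d) × EuclideanSpace ℝ (Fin d),
        (χ n p.1 * χ n p.2) *
        alephTau τ (fun x y => B (Φ x) (Φ y)) p.1 p.2 ∂(μbar.prod μbar)) atTop
      (𝓝 (∫ p : EuclideanSpace ℝ (Fin d) × EuclideanSpace ℝ (Fin d),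
        alephTau τ (fun x y => B (Φ x) (Φ y)) p.1 p.2 ∂(μbar.prod μbar))) := by
    refine tendsto_integral_of_dominated_convergence _ (fun n => ?_) hBi.norm
      (fun n => Eventually.of_forall fun x => hχm _ _ (hχ0 _ _) (hχ1 _ _) (hχ0 _ _) (hχ1 _ _) _)
      (Eventually.of_forall fun x => ?_)
    · exact (((hχc n).comp continuous_fst).mul ((hχc n).comp
        continuous_snd)).aestronglyMeasurable.mul hBi.aestronglyMeasurable
    · simpa using ((hχt x.1).mul (hχt x.2)).mul_const
        (alephTau τ (fun x y => B (Φ x) (Φ y)) x.1 x.2)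
  exact le_of_tendsto' (t1.add t2) hn
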